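/- (Recovery theorem.) Let X be a T0 core compact topological space, let S be a subbasis of X (a family of open sets covering X whose finite intersections form a basis of the topology), and define ⊢ on 𝖥S by F ⊢ G iff ⋂F ⋐ ⋃G (with ⋂∅ = X and ⋃∅ = ∅). Then the map x ↦ S_x = {p ∈ S : x ∈ p} is a homeomorphism from X onto a very dense subspace of the tight spectrum 𝖳^S. This map is surjective (so X is homeomorphic to 𝖳^S) if and only if X is also core coherent and sober. -/

import Mathlib

open scoped Classical

/-! Common definitions: entailment/cover relations on finite subsets,
tight subsets, the tight spectrum, quasi-ideals, and topological notions. -/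

/-- `H` is a *selection* of the finite family `𝒢`: it meets every member of `𝒢`. -/
def IsSelection {S : Type*} (𝒢 : Finset (Finset S)) (H : Finset S) : Prop :=
  ∀ I ∈ 𝒢, ∃ x ∈ I, x ∈ H

/-- Cut-composition `r • s` of relations. -/
def CutComp {A B C : Type*} (r : Finset A → Finset B → Prop)
    (s : Finset B → Finset C → Prop) (F : Finset A) (G : Finset C) : Prop :=
  ∃ ℱ 𝒢 : Finset (Finset B),
    (∀ H ∈ ℱ, r F H) ∧
    (∀ K : Finset B, IsSelection ℱ K → ∃ I ∈ 𝒢, I ⊆ K) ∧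
    (∀ I ∈ 𝒢, s I G)

/-- Upper relation: `F ⊢ G ⊆ H` implies `F ⊢ H`. -/
def IsUpperRel {A B : Type*} (r : Finset A → Finset B → Prop) : Prop :=
  ∀ F G H, r F G → G ⊆ H → r F H

/-- Lower relation: `F ⊢ G` and `F ⊆ E` imply `E ⊢ G`. -/
def IsLowerRel {A B : Type*} (r : Finset A → Finset B → Prop) : Prop :=
  ∀ F G E, r F G → F ⊆ E → r E G

/-- `F ⊢_{1∃} G` iff `F ⊢ {g}` for some `g ∈ G`. -/
def OneExists {A B : Type*} (r : Finset A → Finset B → Prop)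
    (F : Finset A) (G : Finset B) : Prop :=
  ∃ g ∈ G, r F {g}

/-- Cut-transitivity: `⊢ • ⊢ ⊆ ⊢`. -/
def CutTransitive {S : Type*} (r : Finset S → Finset S → Prop) : Prop :=
  ∀ F G, CutComp r r F G → r F G

/-- Divisibility: `⊢ ⊆ ⊢ • ⊢_{1∃}`. -/
def Divisible {S : Type*} (r : Finset S → Finset S → Prop) : Prop :=
  ∀ F G, r F G → CutComp r (OneExists r) F G

/-- A strong idempotent: monotone, cut-transitive and divisible. -/
def StrongIdempotent {S : Type*} (r : Finset S → Finset S → Prop) : Prop :=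
  IsUpperRel r ∧ IsLowerRel r ∧ CutTransitive r ∧ Divisible r

/-- Gentzen's cut rule. -/
def CutRel {S : Type*} (r : Finset S → Finset S → Prop) : Prop :=
  ∀ (s : S) (F G : Finset S), r (insert s F) G → r F (insert s G) → r F G

/-- An entailment: a monotone cut relation. -/
def Entailment {S : Type*} (r : Finset S → Finset S → Prop) : Prop :=
  IsUpperRel r ∧ IsLowerRel r ∧ CutRel r

/-- 1-reflexivity: `{s} ⊢ {s}` for all `s`. -/
def OneReflexive {S : Type*} (r : Finset S → Finset S → Prop) : Prop :=
  ∀ s : S, r {s} {s}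

/-- The relation `⊩` induced by `⊢`:
`F ⊩ G` iff every `H` with `H ⊢ {f}` for all `f ∈ F` satisfies `H ⊢ G`. -/
def Vdash {S : Type*} (r : Finset S → Finset S → Prop)
    (F G : Finset S) : Prop :=
  ∀ H : Finset S, (∀ f ∈ F, r H {f}) → r H G

/-- `⊢` is auxiliary to `⊨`. -/
def AuxiliaryTo {S T : Type*} (r : Finset S → Finset T → Prop)
    (v : Finset S → Finset S → Prop) : Prop :=
  ∀ (F H : Finset S) (G : Finset T), (∀ h ∈ H, r (insert h F) G) → v F H → r F G

/-- `⊢` is dual-auxiliary to `⊨`. -/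
def DualAuxiliaryTo {S : Type*} (r v : Finset S → Finset S → Prop) : Prop :=
  ∀ F G H : Finset S, r H G → (∀ h ∈ H, v F (insert h G)) → r F G

/-- A semicut relation: self-dual-auxiliary. -/
def Semicut {S : Type*} (r : Finset S → Finset S → Prop) : Prop :=
  DualAuxiliaryTo r r

/-- A cover relation: a strong idempotent auxiliary to `⊩`. -/
def CoverRelation {S : Type*} (r : Finset S → Finset S → Prop) : Prop :=
  StrongIdempotent r ∧ AuxiliaryTo r (Vdash r)

/-- Tight subset. -/
def TightSet {S : Type*} (r : Finset S → Finset S → Prop) (T : Set S) : Prop :=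
  ∀ G : Finset S, (∃ F : Finset S, ↑F ⊆ T ∧ r F G) ↔ ∃ g ∈ G, g ∈ T

/-- Round subset. -/
def RoundSet {S : Type*} (r : Finset S → Finset S → Prop) (R : Set S) : Prop :=
  ∀ x ∈ R, ∃ F : Finset S, ↑F ⊆ R ∧ r F {x}

/-- Prime subset. -/
def PrimeSet {S : Type*} (r : Finset S → Finset S → Prop) (P : Set S) : Prop :=
  ∀ F G : Finset S, ↑F ⊆ P → r F G → ∃ g ∈ G, g ∈ P

/-- The tight spectrum: nonempty tight subsets. -/
def TightSpec {S : Type*} (r : Finset S → Finset S → Prop) : Type _ :=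
  {T : Set S // TightSet r T ∧ T.Nonempty}

/-- The underlying set of points of an element of the tight spectrum. -/
def TightSpec.pts {S : Type*} {r : Finset S → Finset S → Prop} (T : TightSpec r) : Set S :=
  Subtype.val T

/-- The spectrum topology, generated by the subbasic sets `𝖳_p = {T | p ∈ T}`. -/
instance TightSpec.instTopologicalSpace {S : Type*} (r : Finset S → Finset S → Prop) :
    TopologicalSpace (TightSpec r) :=
  TopologicalSpace.generateFrom (Set.range fun p : S => {T : TightSpec r | p ∈ T.pts})

/-- `𝖳_F = {T ∈ 𝖳^S : F ⊆ T}`. -/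
def TightSpec.TF {S : Type*} (r : Finset S → Finset S → Prop) (F : Finset S) :
    Set (TightSpec r) :=
  {T : TightSpec r | ↑F ⊆ T.pts}

/-- `𝖳^G = {T ∈ 𝖳^S : T ∩ G ≠ ∅}`. -/
def TightSpec.TG {S : Type*} (r : Finset S → Finset S → Prop) (G : Finset S) :
    Set (TightSpec r) :=
  {T : TightSpec r | ∃ g ∈ G, g ∈ T.pts}

/-- `p ⋐ q`: every open cover of `q` has a finite subcover of `p`. -/
def CompactlyContained {X : Type*} [TopologicalSpace X] (p q : Set X) : Prop :=
  ∀ 𝒰 : Set (Set X), (∀ u ∈ 𝒰, IsOpen u) → q ⊆ ⋃₀ 𝒰 →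
    ∃ 𝒱 : Finset (Set X), ↑𝒱 ⊆ 𝒰 ∧ p ⊆ ⋃₀ ↑𝒱

/-- Core compactness. -/
def CoreCompact (X : Type*) [TopologicalSpace X] : Prop :=
  ∀ p : Set X, IsOpen p → ∀ x ∈ p, ∃ q : Set X, IsOpen q ∧ x ∈ q ∧ CompactlyContained q p

/-- Core coherence. -/
def CoreCoherent (X : Type*) [TopologicalSpace X] : Prop :=
  ∀ p q s : Set X, IsOpen p → IsOpen q → IsOpen s →
    CompactlyContained p q → CompactlyContained p s → CompactlyContained p (q ∩ s)

/-- Sobriety: each irreducible closed set is the closure of a unique point. -/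
def SoberSpace (X : Type*) [TopologicalSpace X] : Prop :=
  ∀ C : Set X, IsIrreducible C → IsClosed C → ∃! x : X, C = closure {x}

/-- Stably locally compact: core compact, core coherent and sober. -/
def StablyLocallyCompact (X : Type*) [TopologicalSpace X] : Prop :=
  CoreCompact X ∧ CoreCoherent X ∧ SoberSpace X

/-- The specialisation preorder: `x → y` iff every open set containing `y` contains `x`. -/
def SpecTo {X : Type*} [TopologicalSpace X] (x y : X) : Prop :=
  ∀ U : Set X, IsOpen U → y ∈ U → x ∈ U

/-- Saturation of a subset. -/
def satOf {X : Type*} [TopologicalSpace X] (D : Set X) : Set X :=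
  {x | ∃ y ∈ D, SpecTo x y}

/-- Saturated subsets. -/
def IsSaturatedSet {X : Type*} [TopologicalSpace X] (K : Set X) : Prop :=
  K = satOf K

/-- The patch topology: generated by open sets together with complements of
compact saturated sets. -/
def patchTopology (X : Type*) [TopologicalSpace X] : TopologicalSpace X :=
  TopologicalSpace.generateFrom
    ({U : Set X | IsOpen U} ∪ {V : Set X | ∃ K : Set X, IsCompact K ∧ IsSaturatedSet K ∧ V = Kᶜ})

/-- Very dense subset: the whole space is both its saturation and its patch-closure. -/
def VeryDense {X : Type*} [TopologicalSpace X] (D : Set X) : Prop :=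
  satOf D = Set.univ ∧ @Dense X (patchTopology X) D

/-- A subbasis: a covering family of open sets generating the topology. -/
def IsSubbasis {X : Type*} [t : TopologicalSpace X] (S : Set (Set X)) : Prop :=
  (∀ p ∈ S, IsOpen p) ∧ ⋃₀ S = Set.univ ∧ TopologicalSpace.generateFrom S = t

/-- The compact cover relation `⊢_⋐` on the finite subsets of a family `S` of
subsets of a space `X`: `F ⊢ G` iff `⋂F ⋐ ⋃G`. -/
def subCover {X : Type*} [TopologicalSpace X] (S : Set (Set X)) :
    Finset ↥S → Finset ↥S → Prop := fun F G =>
  CompactlyContained (⋂ p ∈ F, (p : Set X)) (⋃ p ∈ G, (p : Set X))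

/-- `∩`-roundness of a family of open sets. -/
def CapRound {X : Type*} [TopologicalSpace X] (S : Set (Set X)) : Prop :=
  ∀ p ∈ S, ∀ x ∈ p, ∃ F : Finset ↥S,
    x ∈ (⋂ q ∈ F, (q : Set X)) ∧ CompactlyContained (⋂ q ∈ F, (q : Set X)) p

/-- A pseudosubbasis: a `∩`-round, `T0`-separating family of open sets. -/
def IsPseudoSubbasis {X : Type*} [TopologicalSpace X] (S : Set (Set X)) : Prop :=
  (∀ p ∈ S, IsOpen p) ∧ CapRound S ∧
    ∀ x y : X, x ≠ y → ∃ p ∈ S, (x ∈ p ∧ y ∉ p) ∨ (y ∈ p ∧ x ∉ p)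

/-- A proximal map: continuous and preserving compact containment under preimages. -/
def Proximal {Y X : Type*} [TopologicalSpace Y] [TopologicalSpace X] (φ : Y → X) : Prop :=
  Continuous φ ∧ ∀ O N : Set X, IsOpen O → IsOpen N →
    CompactlyContained O N → CompactlyContained (φ ⁻¹' O) (φ ⁻¹' N)

/-- `𝒬↓`: the finite sets `F` with `F ⊢ 𝒢_⋔` for some finite `𝒢 ⊆ 𝒬`. -/
def downSet {S : Type*} (r : Finset S → Finset S → Prop) (Q : Set (Finset S)) :
    Set (Finset S) :=
  {F | ∃ 𝒢 : Finset (Finset S), ↑𝒢 ⊆ Q ∧ ∀ H : Finset S, IsSelection 𝒢 H → r F H}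

/-- Quasi-ideal: `𝒬 = 𝒬↓`. -/
def QuasiIdeal {S : Type*} (r : Finset S → Finset S → Prop) (Q : Set (Finset S)) : Prop :=
  downSet r Q = Q

/-- `G^⊣ = {F : F ⊢ G}`. -/
def polar {S : Type*} (r : Finset S → Finset S → Prop) (G : Finset S) : Set (Finset S) :=
  {F | r F G}

/-- The way-below relation in the complete lattice of quasi-ideals (where the join
of a family `𝒟` is `(⋃₀𝒟)↓`): `Q ≪ R` iff every nonempty directed family of
quasi-ideals whose join contains `R` has a member containing `Q`. -/
def WayBelowQI {S : Type*} (r : Finset S → Finset S → Prop)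
    (Q R : Set (Finset S)) : Prop :=
  ∀ 𝒟 : Set (Set (Finset S)), (∀ P ∈ 𝒟, QuasiIdeal r P) → 𝒟.Nonempty →
    DirectedOn (· ⊆ ·) 𝒟 → R ⊆ downSet r (⋃₀ 𝒟) → ∃ P ∈ 𝒟, Q ⊆ P

namespace CompactlyContained

variable {X : Type*} [TopologicalSpace X] {p p' q q' : Set X}

lemma mono (h : CompactlyContained p q) (hp : p' ⊆ p) (hq : q ⊆ q') :
    CompactlyContained p' q' := by
  intro 𝒰 h𝒰 hc
  obtain ⟨𝒱, h1, h2⟩ := h 𝒰 h𝒰 (hq.trans hc)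
  exact ⟨𝒱, h1, hp.trans h2⟩

lemma subset (h : CompactlyContained p q) (hq : IsOpen q) : p ⊆ q := by
  obtain ⟨𝒱, h1, h2⟩ := h {q} (by simpa using hq) (by simp)
  intro x hx
  obtain ⟨v, hv, hxv⟩ := h2 hx
  have : v = q := h1 hv
  exact this ▸ hxv

lemma sUnion {𝒱 : Finset (Set X)} (h : ∀ v ∈ 𝒱, CompactlyContained v q) :
    CompactlyContained (⋃₀ (𝒱 : Set (Set X))) q := by
  intro 𝒰 h𝒰 hc
  choose! W hW1 hW2 using fun v hv => h v hv 𝒰 h𝒰 hc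
  refine ⟨𝒱.biUnion W, ?_, ?_⟩
  · intro w hw
    obtain ⟨v, hv, hwv⟩ := Finset.mem_biUnion.1 (Finset.mem_coe.1 hw)
    exact hW1 v hv hwv
  · rintro x ⟨v, hv, hx⟩
    obtain ⟨w, hw, hxw⟩ := hW2 v hv hx
    exact ⟨w, Finset.mem_coe.2 (Finset.mem_biUnion.2 ⟨v, hv, hw⟩), hxw⟩

lemma exists_finset_cover (h : CompactlyContained p q) {P : Set X → Prop}
    (hP : ∀ x ∈ q, ∃ u, IsOpen u ∧ x ∈ u ∧ P u) :
    ∃ 𝒱 : Finset (Set X), (∀ v ∈ 𝒱, P v) ∧ p ⊆ ⋃₀ (𝒱 : Set (Set X)) := by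
  obtain ⟨𝒱, h1, h2⟩ := h {u | IsOpen u ∧ P u} (fun u hu => hu.1) (fun x hx => by
    obtain ⟨u, hu, hxu, hPu⟩ := hP x hx
    exact ⟨u, ⟨hu, hPu⟩, hxu⟩)
  exact ⟨𝒱, fun v hv => (h1 hv).2, h2⟩

lemma exists_mem_ultrafilter (h : CompactlyContained p q) {𝔽 : Ultrafilter X} (hp : p ∈ 𝔽)
    {P : Set X → Prop} (hP : ∀ x ∈ q, ∃ u, IsOpen u ∧ x ∈ u ∧ P u) : ∃ u ∈ 𝔽, P u := by
  obtain ⟨𝒱, h1, h2⟩ := h.exists_finset_cover hP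
  obtain ⟨v, hv, hv'⟩ := (Ultrafilter.finite_sUnion_mem_iff 𝒱.finite_toSet).1
    (Filter.mem_of_superset hp h2)
  exact ⟨v, hv', h1 v hv⟩

end CompactlyContained

section Recovery

variable {X : Type*} [TopologicalSpace X] {S : Set (Set X)}

lemma isOpen_biInter_subbasis (hS : IsSubbasis S) (F : Finset S) :
    IsOpen (⋂ p ∈ F, (p : Set X)) :=
  isOpen_biInter_finset fun p _ => hS.1 p p.2

lemma isOpen_biUnion_subbasis (hS : IsSubbasis S) (G : Finset S) :
    IsOpen (⋃ p ∈ G, (p : Set X)) :=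
  isOpen_biUnion fun p _ => hS.1 p p.2

lemma IsSubbasis.exists_finset (hS : IsSubbasis S) {U : Set X} (hU : IsOpen U) {x : X}
    (hx : x ∈ U) :
    ∃ F : Finset S, x ∈ (⋂ p ∈ F, (p : Set X)) ∧ (⋂ p ∈ F, (p : Set X)) ⊆ U := by
  obtain ⟨_, ⟨f, ⟨hf, hfS⟩, rfl⟩, hxf, hfU⟩ :=
    (TopologicalSpace.isTopologicalBasis_of_subbasis hS.2.2.symm).exists_subset_of_mem_open hx hU
  have hfin : (Subtype.val ⁻¹' f : Set S).Finite := hf.preimage Subtype.val_injective.injOn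
  have key : (⋂ p ∈ hfin.toFinset, (p : Set X)) = ⋂₀ f := by
    ext y
    simp only [Set.Finite.mem_toFinset, Set.mem_preimage, Set.mem_iInter, Set.mem_sInter]
    exact ⟨fun h t ht => h ⟨t, hfS ht⟩ ht, fun h p hp => h p hp⟩
  exact ⟨hfin.toFinset, by rwa [key], by rwa [key]⟩

lemma CoreCompact.exists_finset (hX : CoreCompact X) (hS : IsSubbasis S) {U : Set X}
    (hU : IsOpen U) {x : X} (hx : x ∈ U) :
    ∃ F : Finset S, x ∈ (⋂ p ∈ F, (p : Set X)) ∧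
      CompactlyContained (⋂ p ∈ F, (p : Set X)) U := by
  obtain ⟨q, hq, hxq, hqU⟩ := hX U hU x hx
  obtain ⟨F, hxF, hF⟩ := hS.exists_finset hq hxq
  exact ⟨F, hxF, hqU.mono hF subset_rfl⟩

lemma exists_finset_compactlyContained_biUnion {p : Set X} {𝒱 : Finset (Set X)}
    (hp : p ⊆ ⋃₀ (𝒱 : Set (Set X))) {A : Set S}
    (h : ∀ v ∈ 𝒱, ∃ g ∈ A, CompactlyContained v (g : Set X)) :
    ∃ G : Finset S, ↑G ⊆ A ∧ CompactlyContained p (⋃ g ∈ G, (g : Set X)) := by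
  choose g hgA hg using h
  refine ⟨𝒱.attach.image fun v => g v.1 v.2, ?_, ?_⟩
  · intro s hs
    obtain ⟨v, -, rfl⟩ := Finset.mem_image.1 (Finset.mem_coe.1 hs)
    exact hgA _ _
  · refine (CompactlyContained.sUnion fun v hv => (hg v hv).mono subset_rfl ?_).mono hp subset_rfl
    exact Set.subset_biUnion_of_mem (u := fun s : S => (s : Set X))
      (Finset.mem_image.2 ⟨⟨v, hv⟩, Finset.mem_attach _ _, rfl⟩)

lemma TightSet.not_subCover_of_disjoint {T : Set S} (hT : TightSet (subCover S) T)
    {F G : Finset S} (hF : ↑F ⊆ T) (hG : ↑G ⊆ Tᶜ) : ¬ subCover S F G := fun h => by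
  obtain ⟨g, hg, hgT⟩ := (hT G).1 ⟨F, hF, h⟩
  exact hG hg hgT

lemma TightSet.mem_iff {T : Set S} (hT : TightSet (subCover S) T) (p : S) :
    p ∈ T ↔ ∃ F : Finset S, ↑F ⊆ T ∧ CompactlyContained (⋂ s ∈ F, (s : Set X)) p := by
  have := hT {p}
  simp only [subCover, Finset.mem_singleton, exists_eq_left, Set.iUnion_iUnion_eq_left] at this
  exact this.symm

/-- If `F ⊆ T` with `⋂F ⋐ q`, any family of finite sets `H` whose intersections cover `q`
has a member contained in `T`. -/
lemma TightSet.exists_finset_subset (hX : CoreCompact X) (hS : IsSubbasis S) {T : Set S}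
    (hT : TightSet (subCover S) T) {F : Finset S} (hF : ↑F ⊆ T) {q : Set X}
    (hq : CompactlyContained (⋂ s ∈ F, (s : Set X)) q) {P : Finset S → Prop}
    (hP : ∀ x ∈ q, ∃ H : Finset S, x ∈ (⋂ s ∈ H, (s : Set X)) ∧ P H) :
    ∃ H : Finset S, ↑H ⊆ T ∧ P H := by
  by_contra! hcon
  obtain ⟨𝒱, h𝒱, hc⟩ := hq.exists_finset_cover
    (P := fun u => ∃ g ∈ Tᶜ, CompactlyContained u (g : Set X)) (fun x hx => by
      obtain ⟨H, hxH, hPH⟩ := hP x hx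
      have hHT : ¬ (↑H ⊆ T) := fun h => hcon H h hPH
      obtain ⟨g, hgH, hgT⟩ := Set.not_subset.1 hHT
      obtain ⟨u, hu, hxu, hug⟩ := hX g (hS.1 g g.2) x (Set.mem_iInter₂.1 hxH g hgH)
      exact ⟨u, hu, hxu, g, hgT, hug⟩)
  obtain ⟨G, hG, hFG⟩ := exists_finset_compactlyContained_biUnion hc h𝒱
  exact hT.not_subCover_of_disjoint hF hG hFG

lemma tightSet_points (hX : CoreCompact X) (hS : IsSubbasis S) (x : X) :
    TightSet (subCover S) {p : S | x ∈ (p : Set X)} := by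
  intro G
  constructor
  · rintro ⟨F, hF, hFG⟩
    have := hFG.subset (isOpen_biUnion_subbasis hS G) (Set.mem_iInter₂.2 fun p hp => hF hp)
    simpa using this
  · rintro ⟨g, hg, hxg⟩
    obtain ⟨F, hxF, hF⟩ := hX.exists_finset hS (hS.1 g g.2) hxg
    exact ⟨F, fun p hp => Set.mem_iInter₂.1 hxF p hp, hF.mono subset_rfl
      (Set.subset_biUnion_of_mem (u := fun s : S => (s : Set X)) hg)⟩

lemma IsSubbasis.exists_mem (hS : IsSubbasis S) (x : X) : ∃ p : S, x ∈ (p : Set X) := by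
  obtain ⟨p, hp, hx⟩ := hS.2.1.ge (Set.mem_univ x)
  exact ⟨⟨p, hp⟩, hx⟩

/-- The canonical map `x ↦ S_x` into the tight spectrum. -/
def toTightSpec (hX : CoreCompact X) (hS : IsSubbasis S) (x : X) : TightSpec (subCover S) :=
  ⟨{p : S | x ∈ (p : Set X)}, tightSet_points hX hS x, hS.exists_mem x⟩

lemma isEmbedding_toTightSpec [T0Space X] (hX : CoreCompact X) (hS : IsSubbasis S) :
    Topology.IsEmbedding (toTightSpec hX hS) := by
  have hind : Topology.IsInducing (toTightSpec hX hS) := by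
    refine ⟨?_⟩
    rw [TightSpec.instTopologicalSpace, induced_generateFrom_eq]
    refine hS.2.2.symm.trans (congrArg _ ?_)
    ext p
    constructor
    · intro hp
      exact ⟨_, ⟨⟨p, hp⟩, rfl⟩, rfl⟩
    · rintro ⟨_, ⟨s, rfl⟩, rfl⟩
      exact s.2
  exact hind.isEmbedding

namespace TightSpec

lemma isOpen_TF {A : Type*} (r : Finset A → Finset A → Prop) (F : Finset A) :
    IsOpen (TF r F) := by
  have : TF r F = ⋂ p ∈ F, {T : TightSpec r | p ∈ T.pts} := by
    ext T; simp [TF, Set.subset_def]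
  rw [this]
  exact isOpen_biInter_finset fun p _ => TopologicalSpace.isOpen_generateFrom_of_mem ⟨p, rfl⟩

lemma exists_TF_subset {A : Type*} {r : Finset A → Finset A → Prop} {O : Set (TightSpec r)}
    (hO : IsOpen O) {T : TightSpec r} (hT : T ∈ O) :
    ∃ F : Finset A, T ∈ TF r F ∧ TF r F ⊆ O := by
  induction hO with
  | basic s hs =>
    obtain ⟨p, rfl⟩ := hs
    exact ⟨{p}, by simpa [TF] using hT, fun U hU => by simpa [TF] using hU⟩
  | univ => exact ⟨∅, by simp [TF], Set.subset_univ _⟩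
  | inter s t _ _ ihs iht =>
    obtain ⟨F, hF, hFs⟩ := ihs hT.1
    obtain ⟨G, hG, hGt⟩ := iht hT.2
    refine ⟨F ∪ G, ?_, fun U hU => ?_⟩
    · simpa [TF] using And.intro hF hG
    · have : (F : Set A) ⊆ U.pts ∧ (G : Set A) ⊆ U.pts := by simpa [TF] using hU
      exact ⟨hFs this.1, hGt this.2⟩
  | sUnion 𝒰 _ ih =>
    obtain ⟨u, hu, hTu⟩ := hT
    obtain ⟨F, hF, hFu⟩ := ih u hu hTu
    exact ⟨F, hF, hFu.trans (Set.subset_sUnion_of_mem hu)⟩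

lemma specTo_of_subset {A : Type*} {r : Finset A → Finset A → Prop} {T U : TightSpec r}
    (h : U.pts ⊆ T.pts) : SpecTo T U := by
  intro O hO hU
  obtain ⟨F, hF, hFO⟩ := exists_TF_subset hO hU
  exact hFO (Set.Subset.trans hF h)

end TightSpec

/-- Density in the patch topology can be tested on sets `O \ K` with `O` open and `K` compact. -/
lemma dense_patchTopology {Y : Type*} [TopologicalSpace Y] {D : Set Y}
    (h : ∀ (y : Y) (O K : Set Y), IsOpen O → IsCompact K → y ∈ O → (∀ z ∈ K, ¬ SpecTo y z) →
      ∃ d ∈ D, d ∈ O \ K) : @Dense Y (patchTopology Y) D := by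
  have hb := @TopologicalSpace.isTopologicalBasis_of_subbasis Y (patchTopology Y) _ rfl
  rw [@TopologicalSpace.IsTopologicalBasis.dense_iff Y (patchTopology Y) _ hb _]
  rintro _ ⟨ℱ, ⟨hfin, hℱ⟩, rfl⟩ ⟨y, hy⟩
  change y ∈ ⋂₀ ℱ at hy
  have key : ∃ O K : Set Y, IsOpen O ∧ IsCompact K ∧ y ∈ O ∧ (∀ z ∈ K, ¬ SpecTo y z) ∧
      O \ K ⊆ ⋂₀ ℱ := by
    induction ℱ, hfin using Set.Finite.induction_on with
    | empty => exact ⟨Set.univ, ∅, isOpen_univ, isCompact_empty, trivial, by simp, by simp⟩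
    | @insert a s _ _ ih =>
      rw [Set.sInter_insert] at hy
      obtain ⟨O, K, hO, hK, hyO, hyK, hsub⟩ := ih ((Set.subset_insert _ _).trans hℱ) hy.2
      rcases hℱ (Set.mem_insert _ _) with ha | ⟨L, hL, hLs, rfl⟩
      · refine ⟨a ∩ O, K, ha.inter hO, hK, ⟨hy.1, hyO⟩, hyK, ?_⟩
        rw [Set.sInter_insert]
        exact fun z hz => ⟨hz.1.1, hsub ⟨hz.1.2, hz.2⟩⟩
      · refine ⟨O, L ∪ K, hO, hL.union hK, hyO, ?_, ?_⟩
        · rintro z (hz | hz)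
          · intro hyz
            refine hy.1 ?_
            rw [hLs]
            exact ⟨z, hz, hyz⟩
          · exact hyK z hz
        · rw [Set.sInter_insert]
          exact fun z hz =>
            ⟨fun hzL => hz.2 (Or.inl hzL), hsub ⟨hz.1, fun hzK => hz.2 (Or.inr hzK)⟩⟩
  obtain ⟨O, K, hO, hK, hyO, hyK, hsub⟩ := key
  obtain ⟨d, hd, hdOK⟩ := h y O K hO hK hyO hyK
  exact ⟨d, hsub hdOK, hd⟩

lemma satOf_range_toTightSpec (hX : CoreCompact X) (hS : IsSubbasis S) :
    satOf (Set.range (toTightSpec hX hS)) = Set.univ := by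
  refine Set.eq_univ_of_forall fun T => ?_
  have hT : TightSet (subCover S) T.pts := T.2.1
  obtain ⟨p, hp⟩ : T.pts.Nonempty := T.2.2
  obtain ⟨F, hF, hFp⟩ := (hT.mem_iff p).1 hp
  by_contra hcon
  have hx : ∀ x : X, ∃ g : S, x ∈ (g : Set X) ∧ g ∉ T.pts := fun x => by
    by_contra! hsub
    exact hcon ⟨_, ⟨x, rfl⟩, TightSpec.specTo_of_subset fun g hg => hsub g hg⟩
  obtain ⟨H, hH, g, hg, hgT⟩ := hT.exists_finset_subset hX hS hF hFp
    (P := fun H => ∃ g ∈ H, g ∉ T.pts) (fun x _ => by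
      obtain ⟨g, hxg, hgT⟩ := hx x
      exact ⟨{g}, by simpa using hxg, g, by simp, hgT⟩)
  exact hgT (hH hg)

lemma veryDense_range_toTightSpec (hX : CoreCompact X) (hS : IsSubbasis S) :
    VeryDense (Set.range (toTightSpec hX hS)) := by
  refine ⟨satOf_range_toTightSpec hX hS, dense_patchTopology fun T O K hO hK hTO hTK => ?_⟩
  have hT : TightSet (subCover S) T.pts := T.2.1
  obtain ⟨F, hF, hFO⟩ := TightSpec.exists_TF_subset hO hTO
  let I := {H : Finset S // ∃ g ∈ T.ptsᶜ, CompactlyContained (⋂ s ∈ H, (s : Set X)) g}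
  obtain ⟨t, ht⟩ := hK.elim_finite_subcover (fun H : I => TightSpec.TF (subCover S) H.1)
    (fun H => TightSpec.isOpen_TF _ _) (fun U hU => by
      have hUT : ¬ U.pts ⊆ T.pts := fun h => hTK U hU (TightSpec.specTo_of_subset h)
      obtain ⟨g, hgU, hgT⟩ := Set.not_subset.1 hUT
      obtain ⟨H, hH, hHg⟩ := (TightSet.mem_iff (T := U.pts) U.2.1 g).1 hgU
      exact Set.mem_iUnion.2 ⟨⟨H, g, hgT, hHg⟩, hH⟩)
  by_contra! hcon
  obtain ⟨G, hG, hFG⟩ := exists_finset_compactlyContained_biUnion (A := T.ptsᶜ)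
    (p := ⋂ s ∈ F, (s : Set X)) (𝒱 := t.image fun H : I => ⋂ s ∈ (H.1 : Finset S), (s : Set X)) (fun x hx => by
      have hxK : toTightSpec hX hS x ∈ K := by
        by_contra hxK
        exact hcon _ ⟨x, rfl⟩ ⟨hFO fun p hp => Set.mem_iInter₂.1 hx p hp, hxK⟩
      obtain ⟨H, hHt, hxH⟩ := Set.mem_iUnion₂.1 (ht hxK)
      exact ⟨_, Finset.mem_coe.2 (Finset.mem_image_of_mem _ hHt),
        Set.mem_iInter₂.2 fun s hs => hxH hs⟩) (fun v hv => by
      obtain ⟨H, -, rfl⟩ := Finset.mem_image.1 hv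
      exact H.2)
  exact hT.not_subCover_of_disjoint hF hG hFG

lemma surjective_toTightSpec (hX : CoreCompact X) (hS : IsSubbasis S) (hcoh : CoreCoherent X)
    (hsob : SoberSpace X) : Function.Surjective (toTightSpec hX hS) := by
  intro T
  have hT : TightSet (subCover S) T.pts := T.2.1
  obtain ⟨p₀, hp₀⟩ : T.pts.Nonempty := T.2.2
  let N : Set X → Prop := fun p =>
    ∃ F : Finset S, ↑F ⊆ T.pts ∧ CompactlyContained (⋂ s ∈ F, (s : Set X)) p
  have hNmono {p q : Set X} (hp : N p) (hpq : p ⊆ q) : N q := by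
    obtain ⟨F, hF, h⟩ := hp
    exact ⟨F, hF, h.mono subset_rfl hpq⟩
  let W : Set X := ⋃₀ {p | IsOpen p ∧ ¬ N p}
  have hWo : IsOpen W := isOpen_sUnion fun p hp => hp.1
  have hW : ¬ N W := by
    rintro ⟨F, hF, h⟩
    obtain ⟨H, hH, q, hq, hHq⟩ := hT.exists_finset_subset hX hS hF h
      (P := fun H => ∃ q, ¬ N q ∧ CompactlyContained (⋂ s ∈ H, (s : Set X)) q) (by
        rintro x ⟨q, ⟨hqo, hq⟩, hxq⟩
        obtain ⟨H, hxH, hHq⟩ := hX.exists_finset hS hqo hxq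
        exact ⟨H, hxH, q, hq, hHq⟩)
    exact hq ⟨H, hH, hHq⟩
  have hN {p : Set X} (hp : IsOpen p) : N p ↔ (Wᶜ ∩ p).Nonempty := by
    rw [Set.inter_comm, Set.inter_compl_nonempty_iff]
    exact ⟨fun h hpW => hW (hNmono h hpW), fun h => by
      by_contra hNp
      exact h (Set.subset_sUnion_of_mem (show p ∈ {p | IsOpen p ∧ ¬ N p} from ⟨hp, hNp⟩))⟩
  have hirr : IsIrreducible Wᶜ := by
    refine ⟨?_, fun u v hu hv hWu hWv => ?_⟩
    · exact ((hN (hS.1 p₀ p₀.2)).1 ((hT.mem_iff p₀).1 hp₀)).left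
    · obtain ⟨F, hF, hFu⟩ := (hN hu).2 hWu
      obtain ⟨G, hG, hGv⟩ := (hN hv).2 hWv
      refine (hN (hu.inter hv)).1 ⟨F ∪ G, by simp [hF, hG], ?_⟩
      refine hcoh _ _ _ (isOpen_biInter_subbasis hS _) hu hv (hFu.mono ?_ subset_rfl)
        (hGv.mono ?_ subset_rfl)
      · exact Set.biInter_subset_biInter_left fun s hs => Finset.mem_union_left _ hs
      · exact Set.biInter_subset_biInter_left fun s hs => Finset.mem_union_right _ hs
  obtain ⟨x, hx, -⟩ := hsob _ hirr hWo.isClosed_compl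
  refine ⟨x, Subtype.ext (Set.ext fun p => ?_)⟩
  have hp := hS.1 p p.2
  refine Iff.trans ?_ ((hN hp).symm.trans (hT.mem_iff p).symm)
  rw [hx, closure_inter_open_nonempty_iff hp, Set.singleton_inter_nonempty]
  exact Iff.rfl

lemma soberSpace_of_surjective [T0Space X] (hX : CoreCompact X) (hS : IsSubbasis S)
    (hsurj : Function.Surjective (toTightSpec hX hS)) : SoberSpace X := by
  intro C hC hCc
  have hmeet (F : Finset S) (hF : ∀ p ∈ F, (C ∩ (p : Set X)).Nonempty) :
      (C ∩ ⋂ p ∈ F, (p : Set X)).Nonempty := by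
    induction F using Finset.induction_on with
    | empty => simpa using hC.1
    | insert a F _ ih =>
      rw [Finset.set_biInter_insert]
      exact hC.2 _ _ (hS.1 a a.2) (isOpen_biInter_subbasis hS F) (hF a (by simp))
        (ih fun p hp => hF p (by simp [hp]))
  have hT : TightSet (subCover S) {p : S | (C ∩ (p : Set X)).Nonempty} := by
    intro G
    constructor
    · rintro ⟨F, hF, hFG⟩
      obtain ⟨y, hyC, hy⟩ := hmeet F fun p hp => hF hp
      have := hFG.subset (isOpen_biUnion_subbasis hS G) hy
      obtain ⟨g, hg, hyg⟩ := Set.mem_iUnion₂.1 this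
      exact ⟨g, hg, y, hyC, hyg⟩
    · rintro ⟨g, hg, y, hyC, hyg⟩
      obtain ⟨F, hF, hFG⟩ := (tightSet_points hX hS y G).2 ⟨g, hg, hyg⟩
      exact ⟨F, fun p hp => ⟨y, hyC, hF hp⟩, hFG⟩
  obtain ⟨y, hyC⟩ := hC.1
  obtain ⟨p, hyp⟩ := hS.exists_mem y
  obtain ⟨x, hx⟩ := hsurj ⟨_, hT, p, y, hyC, hyp⟩
  have hxp (p : S) : x ∈ (p : Set X) ↔ (C ∩ (p : Set X)).Nonempty :=
    Set.ext_iff.1 (congrArg Subtype.val hx) p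
  have hCx : C = closure {x} := by
    apply Set.Subset.antisymm
    · intro z hz
      rw [mem_closure_iff]
      intro U hU hzU
      obtain ⟨F, hzF, hFU⟩ := hS.exists_finset hU hzU
      refine ⟨x, hFU (Set.mem_iInter₂.2 fun p hp => (hxp p).2 ⟨z, hz, ?_⟩), rfl⟩
      exact Set.mem_iInter₂.1 hzF p hp
    · refine closure_minimal (Set.singleton_subset_iff.2 ?_) hCc
      by_contra hxC
      obtain ⟨F, hxF, hF⟩ := hS.exists_finset hCc.isOpen_compl hxC
      obtain ⟨z, hzC, hz⟩ := hmeet F fun p hp => (hxp p).1 (Set.mem_iInter₂.1 hxF p hp)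
      exact hF hz hzC
  exact ⟨x, hCx, fun z hz => (inseparable_iff_closure_eq.2 (hz.symm.trans hCx)).eq⟩

/-- The members of `S` with a set in the ultrafilter `𝔽` compactly contained in them. -/
def ultrafilterSet (S : Set (Set X)) (𝔽 : Ultrafilter X) : Set S :=
  {s | ∃ v ∈ 𝔽, CompactlyContained v (s : Set X)}

lemma biInter_mem_of_subset_ultrafilterSet (hS : IsSubbasis S) {𝔽 : Ultrafilter X}
    {F : Finset S} (hF : ↑F ⊆ ultrafilterSet S 𝔽) : (⋂ s ∈ F, (s : Set X)) ∈ 𝔽 := by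
  refine (Filter.biInter_finset_mem F).2 fun s hs => ?_
  obtain ⟨v, hv, hvs⟩ := hF hs
  exact Filter.mem_of_superset hv (hvs.subset (hS.1 s s.2))

lemma exists_finset_subset_ultrafilterSet (hX : CoreCompact X) (hS : IsSubbasis S)
    {𝔽 : Ultrafilter X} {p q : Set X} (hp : p ∈ 𝔽) (hpq : CompactlyContained p q)
    {P : Finset S → Prop} (hP : ∀ x ∈ q, ∃ H : Finset S, x ∈ (⋂ s ∈ H, (s : Set X)) ∧ P H) :
    ∃ H : Finset S, ↑H ⊆ ultrafilterSet S 𝔽 ∧ P H := by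
  obtain ⟨u, hu, H, huH, hPH⟩ := hpq.exists_mem_ultrafilter hp
    (P := fun u => ∃ H : Finset S, CompactlyContained u (⋂ s ∈ H, (s : Set X)) ∧ P H)
    (fun x hx => by
      obtain ⟨H, hxH, hPH⟩ := hP x hx
      obtain ⟨u, huo, hxu, huH⟩ := hX _ (isOpen_biInter_subbasis hS H) x hxH
      exact ⟨u, huo, hxu, H, huH, hPH⟩)
  exact ⟨H, fun s hs => ⟨u, hu, huH.mono subset_rfl (Set.biInter_subset_of_mem hs)⟩, hPH⟩

lemma tightSet_ultrafilterSet (hX : CoreCompact X) (hS : IsSubbasis S) (𝔽 : Ultrafilter X) :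
    TightSet (subCover S) (ultrafilterSet S 𝔽) := by
  intro G
  constructor
  · rintro ⟨F, hF, hFG⟩
    obtain ⟨H, hH, g, hg, hgH⟩ := exists_finset_subset_ultrafilterSet hX hS
      (biInter_mem_of_subset_ultrafilterSet hS hF) hFG
      (P := fun H => ∃ g ∈ G, g ∈ H) (fun x hx => by
        obtain ⟨g, hg, hxg⟩ := Set.mem_iUnion₂.1 hx
        exact ⟨{g}, by simpa using hxg, g, hg, by simp⟩)
    exact ⟨g, hg, hH hgH⟩
  · rintro ⟨g, hg, v, hv, hvg⟩
    obtain ⟨H, hH, hHg⟩ := exists_finset_subset_ultrafilterSet hX hS hv hvg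
      (fun x hx => hX.exists_finset hS (hS.1 g g.2) hx)
    exact ⟨H, hH, hHg.mono subset_rfl
      (Set.subset_biUnion_of_mem (u := fun s : S => (s : Set X)) hg)⟩

lemma coreCoherent_of_surjective (hX : CoreCompact X) (hS : IsSubbasis S)
    (hsurj : Function.Surjective (toTightSpec hX hS)) : CoreCoherent X := by
  intro p q r _ hq hr hpq hpr 𝒰 h𝒰 hc
  by_contra! hcon
  have hfip : ∀ T : Finset (Set X), (T : Set (Set X)) ⊆ insert p (compl '' 𝒰) →
      (⋂₀ (T : Set (Set X))).Nonempty := by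
    intro T hT
    obtain ⟨x, hxp, hx⟩ := Set.not_subset.1
      (hcon ((T.image compl).filter (· ∈ 𝒰)) (fun u hu => (Finset.mem_filter.1 hu).2))
    refine ⟨x, fun t ht => ?_⟩
    rcases hT ht with rfl | ⟨u, hu, rfl⟩
    · exact hxp
    · intro hxu
      refine hx ⟨u, Finset.mem_coe.2 (Finset.mem_filter.2 ⟨?_, hu⟩), hxu⟩
      exact Finset.mem_image.2 ⟨uᶜ, ht, compl_compl u⟩
  obtain ⟨𝔽, h𝔽⟩ := Ultrafilter.exists_ultrafilter_of_finite_inter_nonempty _ hfip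
  have hp𝔽 : p ∈ 𝔽 := h𝔽 (Set.mem_insert _ _)
  obtain ⟨H, hH, s, hs⟩ := exists_finset_subset_ultrafilterSet hX hS hp𝔽 hpq
    (P := fun H => H.Nonempty) (fun x _ => by
      obtain ⟨s, hs⟩ := hS.exists_mem x
      exact ⟨{s}, by simpa using hs, by simp⟩)
  obtain ⟨x, hx⟩ := hsurj ⟨_, tightSet_ultrafilterSet hX hS 𝔽, s, hH hs⟩
  have hxs (s : S) : x ∈ (s : Set X) ↔ s ∈ ultrafilterSet S 𝔽 :=
    Set.ext_iff.1 (congrArg Subtype.val hx) s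
  have hmem {q : Set X} (hq : IsOpen q) (hpq : CompactlyContained p q) : x ∈ q := by
    obtain ⟨H, hH, hHq⟩ := exists_finset_subset_ultrafilterSet hX hS hp𝔽 hpq
      (fun y hy => hS.exists_finset hq hy)
    exact hHq (Set.mem_iInter₂.2 fun s hs => (hxs s).2 (hH hs))
  obtain ⟨u, hu, hxu⟩ := hc ⟨hmem hq hpq, hmem hr hpr⟩
  obtain ⟨F, hxF, hFu⟩ := hS.exists_finset (h𝒰 u hu) hxu
  have hu𝔽 : u ∈ 𝔽 := Filter.mem_of_superset (biInter_mem_of_subset_ultrafilterSet hS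
    fun s hs => (hxs s).1 (Set.mem_iInter₂.1 hxF s hs)) hFu
  exact Ultrafilter.compl_notMem_iff.2 hu𝔽 (h𝔽 (Set.mem_insert_of_mem _ ⟨u, hu, rfl⟩))

end Recovery

/-- **Recovery theorem.** -/
theorem recovery {X : Type*} [TopologicalSpace X] [T0Space X]
    (hX : CoreCompact X) (S : Set (Set X)) (hS : IsSubbasis S) :
    ∃ f : X → TightSpec (subCover S),
      (∀ x : X, (f x).pts = {p : ↥S | x ∈ (p : Set X)}) ∧
      Topology.IsEmbedding f ∧
      VeryDense (Set.range f) ∧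
      (Function.Surjective f ↔ (CoreCoherent X ∧ SoberSpace X)) :=
  ⟨toTightSpec hX hS, fun _ => rfl, isEmbedding_toTightSpec hX hS,
    veryDense_range_toTightSpec hX hS,
    fun h => ⟨coreCoherent_of_surjective hX hS h, soberSpace_of_surjective hX hS h⟩,
    fun h => surjective_toTightSpec hX hS h.1 h.2⟩
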